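/- arXiv:1802.07702 — 2 statements merged into one kernel-verified Lean document; each statement's English description precedes it below -/
import Mathlib

section
/- Let f ∈ ℕ^{2n} be a partial switching flow (with respect to the origin o) with f_{(d,s0(d))} = f_{(d,s1(d))} = 0, let k* be the largest integer k such that the partial run profile after k steps of the run from o to d is componentwise at most f, and let r be the partial run profile after k* steps. Then the end-vertex of f equals the end-vertex of r, i.e., v_f = v_r. -/
/-- One step of the train process: from a configuration (position, current switch
settings), the train moves along the current switch edge of its position and that
switch flips. `false` stands for the switch `s0`, `true` for `s1`. -/
def trainStep {V : Type} [DecidableEq V] (s : Bool → V → V) (st : V × (V → Bool)) :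
    V × (V → Bool) :=
  (s (st.2 st.1) st.1, Function.update st.2 st.1 (!(st.2 st.1)))

/-- Configuration (position, switch settings) of the run of the train from `o` to `d`
after `k` steps; the train starts at `o` with all switches set to `s0` and the process
stops when the train first reaches `d`. -/
def runState {V : Type} [DecidableEq V] (s : Bool → V → V) (o d : V) : ℕ → V × (V → Bool)
  | 0 => (o, fun _ => false)
  | k + 1 =>
      if (runState s o d k).1 = d then runState s o d k
      else trainStep s (runState s o d k)

/-- The partial run profile after `k` steps of the run of the train from `o` to `d`:
for each edge `(v, s b v)` (encoded by the pair `v`, `b`) the number of times the train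
has traversed it during the first `k` steps. -/
def runProfile {V : Type} [DecidableEq V] (s : Bool → V → V) (o d : V) : ℕ → V → Bool → ℕ
  | 0 => fun _ _ => 0
  | k + 1 =>
      if (runState s o d k).1 = d then runProfile s o d k
      else fun v b =>
        runProfile s o d k v b +
          if v = (runState s o d k).1 ∧ b = (runState s o d k).2 (runState s o d k).1
          then 1 else 0

/-- `f : V → Bool → ℕ` (where `f v b` is the value on the edge `(v, s b v)`) is a
switching flow from `o` to `v`: Kirchhoff's law and the parity condition hold. -/
def IsSwitchingFlow {V : Type} [Fintype V] [DecidableEq V] (s : Bool → V → V)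
    (o v : V) (f : V → Bool → ℕ) : Prop :=
  (∀ u : V,
      ((∑ w : V, ∑ b : Bool, if s b w = u then (f w b : ℤ) else 0)
          - ((f u false : ℤ) + (f u true : ℤ)))
        = (if u = v then 1 else 0) - (if u = o then 1 else 0)) ∧
  (∀ u : V, f u true ≤ f u false ∧ f u false ≤ f u true + 1)

/-- The edge `(v, s b v)` belongs to the graph of last-used edges `G*_f`. -/
def LastUsed {V : Type} (f : V → Bool → ℕ) (v : V) (b : Bool) : Prop :=
  (b = false ∧ f v false ≠ f v true) ∨ (b = true ∧ f v false = f v true ∧ 0 < f v true)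

/-- Adjacency of the graph of last-used edges `G*_f`. -/
def GstarAdj {V : Type} (s : Bool → V → V) (f : V → Bool → ℕ) (u w : V) : Prop :=
  ∃ b : Bool, LastUsed f u b ∧ s b u = w

/-- `c` is a directed cycle of the binary relation `adj`: a nonempty list of pairwise
distinct vertices with `adj` holding along the list cyclically. -/
def IsCycle {V : Type} (adj : V → V → Prop) (c : List V) : Prop :=
  c ≠ [] ∧ c.Nodup ∧
    ∀ i : Fin c.length, adj (c.get i) (c.get ⟨(i.1 + 1) % c.length, Nat.mod_lt _ i.pos⟩)

/-- Along the run, profiles increase monotonically. -/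
theorem runProfile_monotone {V : Type} [DecidableEq V] (s : Bool → V → V) (o d : V) :
    Monotone (runProfile s o d) := by
  refine monotone_nat_of_le_succ fun k v b => ?_
  simp only [runProfile]
  split_ifs <;> simp

/-- Once the train has reached `d`, the profile no longer changes. -/
theorem runProfile_eq_of_runState_eq {V : Type} [DecidableEq V] (s : Bool → V → V) (o d : V)
    {k : ℕ} (hk : (runState s o d k).1 = d) (i : ℕ) :
    (runState s o d (k + i)).1 = d ∧ runProfile s o d (k + i) = runProfile s o d k := by
  induction i with
  | zero => exact ⟨hk, rfl⟩
  | succ i ih =>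
    rw [← Nat.add_assoc]
    simp only [runState, runProfile, if_pos ih.1]
    exact ih

/-- The train never traverses an edge leaving `d`. -/
theorem runProfile_destination {V : Type} [DecidableEq V] (s : Bool → V → V) (o d : V)
    (k : ℕ) (b : Bool) : runProfile s o d k d b = 0 := by
  induction k with
  | zero => rfl
  | succ k ih =>
    simp only [runProfile]
    split_ifs with h
    · exact ih
    · have h' : ¬ d = (runState s o d k).1 := fun e => h e.symm
      simp [h', ih]

/-- The switch setting at a vertex records the imbalance of the two edges leaving it. -/
theorem runProfile_false_eq {V : Type} [DecidableEq V] (s : Bool → V → V) (o d : V)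
    (k : ℕ) (v : V) :
    runProfile s o d k v false =
      runProfile s o d k v true + if (runState s o d k).2 v then 1 else 0 := by
  induction k with
  | zero => simp [runProfile, runState]
  | succ k ih =>
    by_cases h : (runState s o d k).1 = d
    · simpa only [runProfile, runState, if_pos h] using ih
    · simp only [runProfile, runState, if_neg h]
      by_cases hv : v = (runState s o d k).1
      · subst hv
        cases hb : (runState s o d k).2 (runState s o d k).1 <;>
          simp_all [trainStep]
      · simp_all [trainStep, Function.update]

/-- Summing over all edges the indicator of one edge. -/
theorem sum_edge_indicator {V M : Type} [Fintype V] [DecidableEq V] [AddCommMonoid M]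
    (x : V) (c : Bool) (g : V → Bool → M) :
    (∑ w : V, ∑ b : Bool, if w = x ∧ b = c then g w b else 0) = g x c := by
  rw [Finset.sum_eq_single x]
  · cases c <;> simp
  · intro w _ hw
    simp [hw]
  · simp

/-- As long as the train has not reached `d`, the profile after `k` steps has total `k`. -/
theorem sum_runProfile {V : Type} [Fintype V] [DecidableEq V] (s : Bool → V → V) (o d : V)
    (h : ∀ k, (runState s o d k).1 ≠ d) (k : ℕ) :
    ∑ v : V, ∑ b : Bool, runProfile s o d k v b = k := by
  induction k with
  | zero => simp [runProfile]
  | succ k ih =>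
    simp only [runProfile, if_neg (h k), Finset.sum_add_distrib]
    rw [ih, sum_edge_indicator _ _ fun _ _ => 1]

/-- Run profiles satisfy Kirchhoff's law. -/
theorem runProfile_kirchhoff {V : Type} [Fintype V] [DecidableEq V] (s : Bool → V → V)
    (o d : V) (k : ℕ) (u : V) :
    ((∑ w : V, ∑ b : Bool, if s b w = u then (runProfile s o d k w b : ℤ) else 0)
        - ((runProfile s o d k u false : ℤ) + (runProfile s o d k u true : ℤ)))
      = (if u = (runState s o d k).1 then 1 else 0) - (if u = o then 1 else 0) := by
  induction k with
  | zero => by_cases h : u = o <;> simp [runProfile, runState, h]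
  | succ k ih =>
    by_cases h : (runState s o d k).1 = d
    · simp only [runProfile, runState, if_pos h]
      exact ih
    · simp only [runProfile, runState, if_neg h, trainStep]
      generalize (runState s o d k).2 (runState s o d k).1 = c at *
      generalize (runState s o d k).1 = x at *
      have hsum := sum_edge_indicator x c fun w b => if s b w = u then (1 : ℤ) else 0
      have hsplit : ∀ w b, (if s b w = u then
          ((runProfile s o d k w b + if w = x ∧ b = c then 1 else 0 : ℕ) : ℤ) else 0)
          = (if s b w = u then (runProfile s o d k w b : ℤ) else 0)
            + if w = x ∧ b = c then (if s b w = u then (1 : ℤ) else 0) else 0 := by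
        intro w b
        split_ifs <;> simp
      simp only [hsplit, Finset.sum_add_distrib, hsum]
      have hout : (((if u = x ∧ false = c then 1 else 0 : ℕ) : ℤ)
          + ((if u = x ∧ true = c then 1 else 0 : ℕ) : ℤ)) = if u = x then 1 else 0 := by
        cases c <;> simp
      have hhead : (if s c x = u then (1 : ℤ) else 0) = if u = s c x then 1 else 0 := by
        simp only [eq_comm]
      push_cast at hout ⊢
      linarith

/-- If a run profile is at most `f` and uses both edges leaving its end-vertex as often as
`f` does, then its end-vertex is the end-vertex of `f`. -/
theorem end_vertex_eq_of_exhausted {V : Type} [Fintype V] [DecidableEq V]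
    {s : Bool → V → V} {o d vf : V} {f : V → Bool → ℕ} (hf : IsSwitchingFlow s o vf f) {k : ℕ}
    (hle : ∀ v b, runProfile s o d k v b ≤ f v b)
    (heq : ∀ b, f (runState s o d k).1 b = runProfile s o d k (runState s o d k).1 b) :
    vf = (runState s o d k).1 := by
  have hflow := hf.1 (runState s o d k).1
  have hrun := runProfile_kirchhoff s o d k (runState s o d k).1
  have hin : (∑ w : V, ∑ b : Bool,
      if s b w = (runState s o d k).1 then (runProfile s o d k w b : ℤ) else 0)
      ≤ ∑ w : V, ∑ b : Bool, if s b w = (runState s o d k).1 then (f w b : ℤ) else 0 := by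
    refine Finset.sum_le_sum fun w _ => Finset.sum_le_sum fun b _ => ?_
    split_ifs
    · exact_mod_cast hle w b
    · exact le_rfl
  rw [heq, heq] at hflow
  rw [if_pos rfl] at hrun
  by_contra hne
  rw [if_neg fun e => hne e.symm] at hflow
  linarith

/-- If a run profile at most `f` cannot be extended by one step below `f`, then it uses both
edges leaving its end-vertex as often as `f` does. -/
theorem exhausted_of_not_succ_le {V : Type} [DecidableEq V]
    {s : Bool → V → V} {o d : V} {f : V → Bool → ℕ}
    (hpar : ∀ u, f u true ≤ f u false ∧ f u false ≤ f u true + 1) {k : ℕ}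
    (hle : ∀ v b, runProfile s o d k v b ≤ f v b)
    (hd : (runState s o d k).1 ≠ d)
    (hnot : ¬ ∀ v b, runProfile s o d (k + 1) v b ≤ f v b) (b : Bool) :
    f (runState s o d k).1 b = runProfile s o d k (runState s o d k).1 b := by
  push Not at hnot
  obtain ⟨v, c, hvc⟩ := hnot
  simp only [runProfile, if_neg hd] at hvc
  split_ifs at hvc with h
  · obtain ⟨rfl, rfl⟩ := h
    have hsw := runProfile_false_eq s o d k (runState s o d k).1
    have hp := hpar (runState s o d k).1
    have h0 := hle (runState s o d k).1 false
    have h1 := hle (runState s o d k).1 true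
    cases hb : (runState s o d k).2 (runState s o d k).1 <;> rw [hb] at hvc hsw <;>
      simp at hsw <;> cases b <;> omega
  · exact absurd (hle v c) (by omega)

/-- Let `f` be a partial switching flow (w.r.t. the origin `o`, with
end-vertex `vf`) vanishing on both outgoing edges of `d`. Then there is a maximal
partial run profile `r = runProfile s o d k` of the run from `o` to `d` that is
componentwise at most `f`, and the end-vertex of `f` equals the end-vertex of `r`. -/
theorem flow_end_vertex_eq_maximal_run_profile_end_vertex
    {V : Type} [Fintype V] [DecidableEq V] (s : Bool → V → V) (o d : V)
    (hd0 : s false d = d) (hd1 : s true d = d)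
    (f : V → Bool → ℕ) (vf : V) (hf : IsSwitchingFlow s o vf f)
    (hfd0 : f d false = 0) (hfd1 : f d true = 0) :
    ∃ k : ℕ,
      (∀ v b, runProfile s o d k v b ≤ f v b) ∧
      (∀ j : ℕ, (∀ v b, runProfile s o d j v b ≤ f v b) →
        ∀ v b, runProfile s o d j v b ≤ runProfile s o d k v b) ∧
      vf = (runState s o d k).1 := by
  obtain ⟨k, hle, hk⟩ : ∃ k, (∀ v b, runProfile s o d k v b ≤ f v b) ∧
      ((runState s o d k).1 = d ∨ ¬ ∀ v b, runProfile s o d (k + 1) v b ≤ f v b) := by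
    by_contra! hcon
    have hall : ∀ k v b, runProfile s o d k v b ≤ f v b := by
      intro k
      induction k with
      | zero => exact fun _ _ => Nat.zero_le _
      | succ k ih => exact (hcon k ih).2
    have hsum := sum_runProfile s o d (fun k => (hcon k (hall k)).1)
      ((∑ v : V, ∑ b : Bool, f v b) + 1)
    have hbound := Finset.sum_le_sum fun (v : V) (_ : v ∈ Finset.univ) =>
      Finset.sum_le_sum fun (b : Bool) (_ : b ∈ Finset.univ) =>
        hall ((∑ v : V, ∑ b : Bool, f v b) + 1) v b
    omega
  refine ⟨k, hle, fun j hj => ?_, ?_⟩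
  · rcases le_total j k with hjk | hkj
    · exact runProfile_monotone s o d hjk
    · rcases hk with hk | hk
      · obtain ⟨i, rfl⟩ := Nat.exists_eq_add_of_le hkj
        rw [(runProfile_eq_of_runState_eq s o d hk i).2]
        exact fun _ _ => le_rfl
      · obtain rfl | hlt := hkj.eq_or_lt
        · exact fun _ _ => le_rfl
        · exact absurd (fun v b => (runProfile_monotone s o d hlt v b).trans (hj v b)) hk
  · by_cases hd : (runState s o d k).1 = d
    · refine end_vertex_eq_of_exhausted hf hle fun b => ?_
      rw [hd, runProfile_destination]
      cases b <;> assumption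
    · exact end_vertex_eq_of_exhausted hf hle
        (exhausted_of_not_succ_le hf.2 hle hd (hk.resolve_left hd))
end

section
/- If at some step k of the run of the train from o to d the partial run profile r after k steps satisfies r_e ≥ 2^n + 1 for some edge e ∈ E (where n = |V|), then the run from o to d never terminates, i.e., the train never reaches d. -/
theorem runState_add_eq_of_eq {V : Type} [DecidableEq V] {s : Bool → V → V} {o d : V} {i j : ℕ}
    (hij : runState s o d i = runState s o d j) (t : ℕ) :
    runState s o d (i + t) = runState s o d (j + t) := by
  induction t with
  | zero => exact hij
  | succ t ih => rw [← Nat.add_assoc, ← Nat.add_assoc, runState, runState, ih]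

theorem runState_fst_eq_of_le {V : Type} [DecidableEq V] {s : Bool → V → V} {o d : V} {m k : ℕ}
    (hmk : m ≤ k) (hm : (runState s o d m).1 = d) : (runState s o d k).1 = d := by
  induction k, hmk using Nat.le_induction with
  | base => exact hm
  | succ k _ ih => rwa [runState, if_pos ih]

/-- If the train reaches `d`, then no configuration away from `d` occurs twice. -/
theorem runState_ne_of_lt {V : Type} [DecidableEq V] {s : Bool → V → V} {o d : V}
    (hreach : ∃ m, (runState s o d m).1 = d) {i j : ℕ} (hij : i < j)
    (hj : (runState s o d j).1 ≠ d) : runState s o d i ≠ runState s o d j := by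
  intro heq
  have hlt : j < Nat.find hreach := by
    by_contra! hle
    exact hj (runState_fst_eq_of_le hle (Nat.find_spec hreach))
  refine Nat.find_min hreach (m := i + (Nat.find hreach - j)) (by omega) ?_
  rw [runState_add_eq_of_eq heq, Nat.add_sub_cancel' hlt.le]
  exact Nat.find_spec hreach

open Classical in
/-- If the train reaches `d`, then each edge is traversed at most as often as there are switch
settings with which the train has visited its tail. -/
theorem runProfile_le_card {V : Type} [Fintype V] [DecidableEq V] {s : Bool → V → V} {o d : V}
    (hreach : ∃ m, (runState s o d m).1 = d) (k : ℕ) (v : V) (b : Bool) :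
    runProfile s o d k v b ≤
      (Finset.univ.filter fun σ : V → Bool => ∃ i < k, runState s o d i = (v, σ)).card := by
  induction k with
  | zero => simp [runProfile]
  | succ k ih =>
    have hmono : (Finset.univ.filter fun σ : V → Bool => ∃ i < k, runState s o d i = (v, σ)) ⊆
        Finset.univ.filter fun σ : V → Bool => ∃ i < k + 1, runState s o d i = (v, σ) :=
      Finset.monotone_filter_right _ fun _ _ ⟨i, hi, h⟩ => ⟨i, hi.trans k.lt_succ_self, h⟩
    rw [runProfile]
    split_ifs with hd
    · exact ih.trans (Finset.card_le_card hmono)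
    · dsimp only
      split_ifs with hv
      · refine (Nat.succ_le_succ ih).trans (Finset.card_lt_card ?_)
        refine (Finset.ssubset_iff_of_subset hmono).2 ⟨(runState s o d k).2, ?_, ?_⟩
        · exact Finset.mem_filter.2 ⟨Finset.mem_univ _, k, k.lt_succ_self, Prod.ext hv.1.symm rfl⟩
        · simp only [Finset.mem_filter, Finset.mem_univ, true_and]
          rintro ⟨i, hi, h⟩
          exact runState_ne_of_lt hreach hi hd (h.trans (Prod.ext hv.1 rfl))
      · exact ih.trans (Finset.card_le_card hmono)

/-- If at some step `k` of the run of the train from `o` to `d` the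
partial run profile has value at least `2 ^ n + 1` on some edge (where `n = |V|`), then
the run never terminates, i.e., the train never reaches `d`. -/
theorem large_partial_run_profile_implies_nontermination
    {V : Type} [Fintype V] [DecidableEq V] (s : Bool → V → V) (o d : V)
    (hd0 : s false d = d) (hd1 : s true d = d)
    (k : ℕ) (v : V) (b : Bool)
    (h : 2 ^ Fintype.card V + 1 ≤ runProfile s o d k v b) :
    ∀ m : ℕ, (runState s o d m).1 ≠ d := by
  classical
  intro m hm
  have hle := (runProfile_le_card ⟨m, hm⟩ k v b).trans (Finset.card_le_univ _)
  rw [Fintype.card_fun, Fintype.card_bool] at hle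
  omega
end
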